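/- There exists an absolute constant C > 0 such that for all integers b ≥ 1 and ℓ ≥ 1 there is a connected simple graph G_{b,ℓ} with the following properties: (i) its number of vertices n satisfies 2^{bℓ} ≤ n ≤ 2^{bℓ} · 2^{C(b + log₂(ℓ+1))}; (ii) its maximum degree is at most 3; (iii) every hub labeling (S_v)_{v∈V} of G_{b,ℓ} satisfies ∑_{v∈V} |S_v| ≥ n · 2^{bℓ} · 2^{−C(b+ℓ)}. -/

import Mathlib

/-- A hub labeling of a (connected) simple graph `G`: a family of finite hub sets
`S v` such that every pair `u, v` has a common hub on a shortest `u`-`v` path. -/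
def IsHubLabeling {V : Type*} (G : SimpleGraph V) (S : V → Finset V) : Prop :=
  ∀ u v : V, ∃ w : V, w ∈ S u ∧ w ∈ S v ∧ G.dist u w + G.dist w v = G.dist u v

namespace SimpleGraph

variable {V : Type*} {G : SimpleGraph V}

/-- A function changing by at most one along each edge changes by at most the length of a walk. -/
theorem Walk.sub_le_length_of_lipschitz {f : V → ℤ} (hf : ∀ u v, G.Adj u v → |f v - f u| ≤ 1)
    {u v : V} (p : G.Walk u v) : f v - f u ≤ p.length := by
  induction p with
  | nil => simp
  | cons h p ih =>
    have := le_of_abs_le (hf _ _ h)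
    push_cast [Walk.length_cons]
    linarith

theorem Connected.sub_le_dist_of_lipschitz (hG : G.Connected) {f : V → ℤ}
    (hf : ∀ u v, G.Adj u v → |f v - f u| ≤ 1) (u v : V) : f v - f u ≤ G.dist u v := by
  obtain ⟨p, hp⟩ := hG.exists_walk_length_eq_dist u v
  exact hp ▸ p.sub_le_length_of_lipschitz hf

/-- If `X a`, `Y a` are pairs of vertices such that every vertex between them has `M a` between it
and one of the endpoints, and `a` is determined by either endpoint and `M a`, then hub labelings
have total size at least half the number of pairs. -/
theorem Connected.card_le_two_mul_sum_card_of_isHubLabeling [Fintype V] {P : Type*} [Fintype P]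
    (hG : G.Connected) (X Y M : P → V)
    (hM : ∀ a w, G.dist (X a) w + G.dist w (Y a) = G.dist (X a) (Y a) →
      G.dist (X a) (M a) + G.dist (M a) w = G.dist (X a) w ∨
        G.dist w (M a) + G.dist (M a) (Y a) = G.dist w (Y a))
    (hinj : ∀ a a', X a = X a' ∨ Y a = Y a' →
      G.dist (X a') (M a) + G.dist (M a) (Y a') = G.dist (X a') (Y a') → a = a')
    {S : V → Finset V} (hS : IsHubLabeling G S) :
    Fintype.card P ≤ 2 * ∑ v, (S v).card := by
  classical
  choose w hwX hwY hw using fun a => hS (X a) (Y a)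
  let left (a : P) : Prop := G.dist (X a) (M a) + G.dist (M a) (w a) = G.dist (X a) (w a)
  let charge (a : P) : Bool × (Σ v, S v) :=
    if left a then (true, ⟨X a, w a, hwX a⟩) else (false, ⟨Y a, w a, hwY a⟩)
  have hmem : ∀ {v v' : V} (_ : v = v') (a : S v) (a' : S v'), a ≍ a' → (a : V) = a' := by
    rintro v _ rfl a a' h
    rw [eq_of_heq h]
  have hcharge : Function.Injective charge := by
    intro a a' h
    have key : (X a = X a' ∧ w a = w a' ∧ left a) ∨
        (Y a = Y a' ∧ w a = w a' ∧
          G.dist (w a) (M a) + G.dist (M a) (Y a) = G.dist (w a) (Y a)) := by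
      have hr := (hM a (w a) (hw a))
      by_cases h1 : left a <;> by_cases h2 : left a' <;>
        simp only [charge, h1, h2, if_true, if_false, Prod.mk.injEq, Sigma.mk.injEq, true_and,
          Bool.false_eq_true, Bool.true_eq_false, false_and] at h
      · obtain ⟨hX, hw'⟩ := h
        refine Or.inl ⟨hX, ?_, h1⟩
        exact hmem hX _ _ hw'
      · obtain ⟨hY, hw'⟩ := h
        refine Or.inr ⟨hY, ?_, hr.resolve_left h1⟩
        exact hmem hY _ _ hw'
    have t1 := hG.dist_triangle (u := X a') (v := M a) (w := Y a')
    have t2 := hG.dist_triangle (u := M a) (v := w a) (w := Y a')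
    have t3 := hG.dist_triangle (u := X a') (v := w a) (w := M a)
    have hwa' := hw a'
    rcases key with ⟨hX, hww, hl⟩ | ⟨hY, hww, hl⟩
    · refine hinj a a' (Or.inl hX) ?_
      simp only [left, hX] at hl
      rw [← hww] at hwa'
      omega
    · refine hinj a a' (Or.inr hY) ?_
      rw [hY] at hl
      rw [← hww] at hwa'
      omega
  have := Fintype.card_le_of_injective charge hcharge
  simpa using this

theorem Iso.dist_eq {W : Type*} {H : SimpleGraph W} (e : G ≃g H) (hG : G.Connected) (u v : V) :
    H.dist (e u) (e v) = G.dist u v := by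
  apply le_antisymm
  · obtain ⟨p, hp⟩ := hG.exists_walk_length_eq_dist u v
    rw [← hp, ← Walk.length_map e.toHom p]
    exact dist_le _
  · obtain ⟨p, hp⟩ := (e.connected_iff.1 hG).exists_walk_length_eq_dist (e u) (e v)
    have h := dist_le (p.map e.symm.toHom)
    have hu : ∀ x, e.symm.toHom (e x) = x := e.symm_apply_apply
    rwa [Walk.length_map, hp, hu, hu] at h

/-- Hub labelings pull back along isomorphisms of connected graphs. -/
theorem Iso.isHubLabeling_map {W : Type*} {H : SimpleGraph W} (e : G ≃g H) (hG : G.Connected)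
    {S : W → Finset W} (hS : IsHubLabeling H S) :
    IsHubLabeling G fun v => (S (e v)).map e.symm.toEquiv.toEmbedding := by
  intro u v
  obtain ⟨w, hu, hv, h⟩ := hS (e u) (e v)
  refine ⟨e.symm w, Finset.mem_map_of_mem _ hu, Finset.mem_map_of_mem _ hv, ?_⟩
  rw [← e.dist_eq hG, ← e.dist_eq hG, ← e.dist_eq hG, e.apply_symm_apply, h]

end SimpleGraph

/-- There is a walk from `u` to `v` of length `n`. -/
def SimpleGraph.HasWalk {V : Type*} (G : SimpleGraph V) (u v : V) (n : ℤ) : Prop :=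
  ∃ p : G.Walk u v, (p.length : ℤ) = n

namespace SimpleGraph.HasWalk

variable {V : Type*} {G : SimpleGraph V} {u v w : V} {m n : ℤ}

theorem refl (u : V) : G.HasWalk u u 0 := ⟨.nil, rfl⟩

theorem of_adj (h : G.Adj u v) : G.HasWalk u v 1 := ⟨h.toWalk, rfl⟩

theorem trans (h : G.HasWalk u v m) (h' : G.HasWalk v w n) : G.HasWalk u w (m + n) := by
  obtain ⟨p, rfl⟩ := h
  obtain ⟨q, rfl⟩ := h'
  exact ⟨p.append q, by simp⟩

theorem symm (h : G.HasWalk u v n) : G.HasWalk v u n := by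
  obtain ⟨p, rfl⟩ := h
  exact ⟨p.reverse, by simp⟩

theorem reachable (h : G.HasWalk u v n) : G.Reachable u v := ⟨h.choose⟩

theorem dist_le (h : G.HasWalk u v n) : (G.dist u v : ℤ) ≤ n := by
  obtain ⟨p, rfl⟩ := h
  exact_mod_cast SimpleGraph.dist_le p

end SimpleGraph.HasWalk

/-- Vertices of the comb graph: for each side, level and coordinate vector there is a comb whose
spine has positions in `[-4s², 4s²]` and whose teeth have depth `12s²`. -/
@[ext]
structure CombVertex (ℓ s : ℕ) where
  side : Bool
  level : ℕ
  level_le : level ≤ ℓ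
  coord : Fin ℓ → Fin s
  spine : ℤ
  neg_le_spine : -(4 * s ^ 2 : ℤ) ≤ spine
  spine_le : spine ≤ 4 * s ^ 2
  depth : ℕ
  depth_le : depth ≤ 12 * s ^ 2

/-- The position on the spine of the port that changes a coordinate by `d`. -/
def combPort (d : ℤ) : ℤ := 2 * d ^ 2 + d + 1

theorem combPort_pos (d : ℤ) : 0 < combPort d := by
  unfold combPort
  nlinarith [sq_nonneg d, sq_nonneg (d + 1)]

theorem combPort_injective : Function.Injective combPort := by
  intro a b h
  unfold combPort at h
  have h' : (a - b) * (2 * (a + b) + 1) = 0 := by linear_combination h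
  rcases mul_eq_zero.1 h' with h' | h' <;> omega

theorem combPort_le {s : ℕ} {d : ℤ} (h : |d| < s) : combPort d ≤ 4 * s ^ 2 := by
  obtain ⟨h1, h2⟩ := abs_lt.1 h
  unfold combPort
  nlinarith

namespace CombVertex

variable {ℓ s : ℕ}

/-- Oriented edges of the comb graph. -/
inductive Step : CombVertex ℓ s → CombVertex ℓ s → Prop
  | spine {u v} (hside : v.side = u.side) (hlevel : v.level = u.level) (hcoord : v.coord = u.coord)
      (hspine : v.spine = u.spine + 1) (hu : u.depth = 0) (hv : v.depth = 0) : Step u v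
  | tooth {u v} (hside : v.side = u.side) (hlevel : v.level = u.level) (hcoord : v.coord = u.coord)
      (hspine : v.spine = u.spine) (hdepth : v.depth = u.depth + 1) : Step u v
  | port {u v} (i : Fin ℓ) (hside : v.side = u.side) (hul : u.level = (i : ℕ))
      (hvl : v.level = (i : ℕ) + 1)
      (hcoord : ∀ j, j ≠ i → v.coord j = u.coord j)
      (hus : u.spine = combPort ((v.coord i : ℤ) - u.coord i))
      (hvs : v.spine = -combPort ((u.coord i : ℤ) - v.coord i))
      (hu : u.depth = 12 * s ^ 2) (hv : v.depth = 12 * s ^ 2) : Step u v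
  | bridge {u v} (hus : u.side = false) (hvs : v.side = true) (hul : u.level = ℓ)
      (hvl : v.level = ℓ) (hcoord : v.coord = u.coord) (hu0 : u.spine = 0) (hv0 : v.spine = 0)
      (hu : u.depth = 12 * s ^ 2) (hv : v.depth = 12 * s ^ 2) : Step u v

theorem Step.ne {u v : CombVertex ℓ s} (h : Step u v) : u ≠ v := by
  rintro rfl
  cases h <;> first | omega | simp_all

/-- The comb graph. -/
def graph (ℓ s : ℕ) : SimpleGraph (CombVertex ℓ s) where
  Adj u v := Step u v ∨ Step v u
  symm := ⟨fun _ _ h => Or.symm h⟩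
  loopless := ⟨fun _ h => h.elim (fun h => h.ne rfl) fun h => h.ne rfl⟩

/-- Comb vertices as tuples. -/
def equivProd (ℓ s : ℕ) : CombVertex ℓ s ≃ Bool × Fin (ℓ + 1) × (Fin ℓ → Fin s) ×
    Finset.Icc (-(4 * s ^ 2 : ℤ)) (4 * s ^ 2) × Fin (12 * s ^ 2 + 1) where
  toFun v := ⟨v.side, ⟨v.level, Nat.lt_succ_of_le v.level_le⟩, v.coord,
    ⟨v.spine, Finset.mem_Icc.2 ⟨v.neg_le_spine, v.spine_le⟩⟩,
    ⟨v.depth, Nat.lt_succ_of_le v.depth_le⟩⟩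
  invFun t := ⟨t.1, t.2.1, Nat.le_of_lt_succ t.2.1.2, t.2.2.1, t.2.2.2.1,
    (Finset.mem_Icc.1 t.2.2.2.1.2).1, (Finset.mem_Icc.1 t.2.2.2.1.2).2, t.2.2.2.2,
    Nat.le_of_lt_succ t.2.2.2.2.2⟩
  left_inv _ := rfl
  right_inv _ := rfl

noncomputable instance : Fintype (CombVertex ℓ s) := Fintype.ofEquiv _ (equivProd ℓ s).symm

theorem card_eq : Fintype.card (CombVertex ℓ s) =
    2 * ((ℓ + 1) * (s ^ ℓ * ((8 * s ^ 2 + 1) * (12 * s ^ 2 + 1)))) := by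
  rw [Fintype.card_congr (equivProd ℓ s)]
  simp only [Fintype.card_prod, Fintype.card_bool, Fintype.card_fin, Fintype.card_fun,
    Fintype.card_coe, Int.card_Icc]
  congr 5
  zify
  rw [Int.toNat_of_nonneg (by nlinarith [sq_nonneg (s : ℤ)])]
  ring

/-- A label separating the neighbours of a vertex. -/
def neighborLabel (v u : CombVertex ℓ s) : Fin 3 :=
  if u.spine = v.spine + 1 ∨ u.depth + 1 = v.depth then 0
  else if u.spine + 1 = v.spine then 1 else 2

theorem ncard_neighborSet_le (hs : 0 < s) (v : CombVertex ℓ s) :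
    ((graph ℓ s).neighborSet v).ncard ≤ 3 := by
  have hs2 : 0 < s ^ 2 := by positivity
  have h := Set.ncard_le_ncard_of_injOn (s := (graph ℓ s).neighborSet v) (t := Set.univ)
    (neighborLabel v) (fun _ _ => Set.mem_univ _) ?_
  · simpa [Set.ncard_univ] using h
  intro a ha b hb hab
  simp only [neighborLabel] at hab
  have hp := combPort_pos
  have hda := a.depth_le
  have hdb := b.depth_le
  have hcoord {i : Fin ℓ} {x y z : Fin ℓ → Fin s} (hx : ∀ j, j ≠ i → x j = z j)
      (hy : ∀ j, j ≠ i → y j = z j) (h : x i = y i) : x = y := by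
    funext j
    by_cases hj : j = i
    · rw [hj, h]
    · rw [hx j hj, hy j hj]
  rcases ha with ha | ha <;> rcases hb with hb | hb <;> cases ha <;> cases hb <;>
    first
      | (exfalso; clear hcoord; grind)
      | (clear hcoord hp hab; ext1 <;> grind)
      | skip
  · rename_i i hsa hul hla hca hua hva _ _ j hsb hul' hlb hcb hub hvb _ _
    obtain rfl : i = j := Fin.ext (by omega)
    have h : a.coord i = b.coord i := by
      have := combPort_injective (hua.symm.trans hub)
      exact Fin.ext (by omega)
    refine CombVertex.ext (by simp_all) (by omega) (hcoord hca hcb h) ?_ (by omega)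
    rw [hva, hvb, h]
  · rename_i i hsa hul hla hca hua hva _ _ j hsb hul' hlb hcb hub hvb _ _
    obtain rfl : i = j := Fin.ext (by omega)
    have h : a.coord i = b.coord i := by
      have := combPort_injective (neg_injective (hva.symm.trans hvb))
      exact Fin.ext (by omega)
    refine CombVertex.ext (by simp_all) (by omega)
      (hcoord (fun j hj => (hca j hj).symm) (fun j hj => (hcb j hj).symm) h) ?_ (by omega)
    rw [hua, hub, h]

/-- The deviation of coordinate `n` from `x`, zero out of range. -/
def deviation (x z : Fin ℓ → Fin s) (n : ℕ) : ℤ :=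
  if h : n < ℓ then (z ⟨n, h⟩ : ℤ) - x ⟨n, h⟩ else 0

theorem deviation_val (x z : Fin ℓ → Fin s) (i : Fin ℓ) :
    deviation x z i = (z i : ℤ) - x i := by
  simp [deviation]

theorem abs_deviation_lt (hs : 0 < s) (x z : Fin ℓ → Fin s) (n : ℕ) : |deviation x z n| < s := by
  unfold deviation
  split_ifs with h
  · rw [abs_lt]; omega
  · simpa using hs

/-- A lower bound for the distance from the level-zero vertex at `x` to the comb at `z`
on level `n`. -/
def baseHeight (x z : Fin ℓ → Fin s) (n : ℕ) : ℤ :=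
  n * (24 * s ^ 2 + 3) + ∑ j : Fin ℓ, if (j : ℕ) < n then 4 * ((z j : ℤ) - x j) ^ 2
    else if (z j : ℤ) - x j = 0 then 0 else 4 * (s : ℤ) ^ 2

theorem baseHeight_succ (x : Fin ℓ → Fin s) {z z' : Fin ℓ → Fin s} {i : Fin ℓ}
    (h : ∀ j, j ≠ i → z' j = z j) :
    baseHeight x z' (i + 1) = baseHeight x z i + (24 * s ^ 2 + 3) + 4 * ((z' i : ℤ) - x i) ^ 2 -
      if (z i : ℤ) - x i = 0 then 0 else 4 * (s : ℤ) ^ 2 := by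
  unfold baseHeight
  rw [← Finset.add_sum_erase _ _ (Finset.mem_univ i),
    ← Finset.add_sum_erase (a := i) _ _ (Finset.mem_univ i)]
  have hsum : ∀ j ∈ Finset.univ.erase i,
      (if (j : ℕ) < i + 1 then 4 * ((z' j : ℤ) - x j) ^ 2
        else if (z' j : ℤ) - x j = 0 then 0 else 4 * (s : ℤ) ^ 2) =
      if (j : ℕ) < i then 4 * ((z j : ℤ) - x j) ^ 2
        else if (z j : ℤ) - x j = 0 then 0 else 4 * (s : ℤ) ^ 2 := by
    intro j hj
    have hne := Finset.ne_of_mem_erase hj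
    have : (j : ℕ) < i + 1 ↔ (j : ℕ) < i := by
      have := Fin.val_ne_of_ne hne
      omega
    simp only [this, h j hne]
  rw [Finset.sum_congr rfl hsum]
  simp only [lt_add_one, if_true, lt_irrefl, if_false]
  push_cast
  ring

theorem baseHeight_zero (x : Fin ℓ → Fin s) : baseHeight x x 0 = 0 := by
  simp [baseHeight]

theorem baseHeight_last (x z : Fin ℓ → Fin s) :
    baseHeight x z ℓ = ℓ * (24 * s ^ 2 + 3) + 4 * ∑ j, ((z j : ℤ) - x j) ^ 2 := by
  simp [baseHeight, Finset.mul_sum]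

/-- A function that is `1`-Lipschitz on the comb graph and bounds the distance from the level-zero
vertex at `x` from below. -/
def potential (x : Fin ℓ → Fin s) (v : CombVertex ℓ s) : ℤ :=
  if 0 ≤ v.spine then
    min (baseHeight x v.coord v.level + v.spine + v.depth)
      (baseHeight x v.coord v.level -
        (if deviation x v.coord v.level = 0 then 0 else 4 * (s : ℤ) ^ 2) + 16 * s ^ 2)
  else if v.spine = -combPort (-deviation x v.coord (v.level - 1)) then
    baseHeight x v.coord v.level + v.spine - v.depth
  else
    max (baseHeight x v.coord v.level + v.spine - v.depth)
      (baseHeight x v.coord v.level - 4 * deviation x v.coord (v.level - 1) ^ 2 - 8 * s ^ 2 - 3)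

theorem potential_of_depth_eq_zero (hs : 0 < s) (x : Fin ℓ → Fin s) {v : CombVertex ℓ s}
    (hv : v.depth = 0) : potential x v = baseHeight x v.coord v.level + v.spine := by
  have h1 := v.neg_le_spine
  have h2 := v.spine_le
  have hs2 : 0 < (s : ℤ) ^ 2 := by positivity
  have := sq_nonneg (deviation x v.coord (v.level - 1))
  unfold potential
  rw [hv]
  push_cast
  split_ifs <;> first
    | rw [min_eq_left (by linarith)]; ring
    | rw [max_eq_left (by linarith)]; ring
    | ring

theorem abs_potential_sub_le_of_step (hs : 0 < s) (x : Fin ℓ → Fin s) {u v : CombVertex ℓ s}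
    (h : Step u v) : |potential x v - potential x u| ≤ 1 := by
  have hs2 : 0 < (s : ℤ) ^ 2 := by positivity
  cases h with
  | spine hside hlevel hcoord hspine hu hv =>
    rw [potential_of_depth_eq_zero hs x hu, potential_of_depth_eq_zero hs x hv, hcoord, hlevel,
      hspine]
    simp
  | tooth hside hlevel hcoord hspine hdepth =>
    unfold potential
    rw [hcoord, hlevel, hspine, hdepth]
    push_cast
    rw [abs_le]
    split_ifs <;> omega
  | bridge hus hvs hul hvl hcoord hu0 hv0 hu hv =>
    unfold potential
    rw [hcoord, hul, hvl, hu0, hv0, hu, hv]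
    simp
  | port i hside hul hvl hcoord hus hvs hu hv =>
    have hup := hus ▸ combPort_pos ((v.coord i : ℤ) - u.coord i)
    have hvp := hvs ▸ neg_neg_of_pos (combPort_pos ((u.coord i : ℤ) - v.coord i))
    have hule := u.spine_le
    have hdev := abs_lt.1 (abs_deviation_lt hs x v.coord i)
    rw [deviation_val] at hdev
    have hbase := baseHeight_succ x hcoord
    unfold potential
    rw [if_pos hup.le, if_neg (not_le.2 hvp), hul, hvl, Nat.add_sub_cancel, deviation_val,
      deviation_val, hbase, hu, hv]
    push_cast
    by_cases hz : (u.coord i : ℤ) - x i = 0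
    · have huv : (v.coord i : ℤ) - u.coord i = v.coord i - x i := by omega
      have hvu : (u.coord i : ℤ) - v.coord i = -(v.coord i - x i) := by omega
      rw [hvu] at hvs
      rw [huv] at hus
      rw [if_pos hz, if_pos hvs, min_eq_left (by linarith), hus, hvs, abs_le]
      unfold combPort
      constructor <;> linarith
    · have hne : v.spine ≠ -combPort (-((v.coord i : ℤ) - x i)) := by
        rw [hvs]
        intro h
        have := combPort_injective (neg_injective h)
        omega
      have hsq : ((v.coord i : ℤ) - x i) ^ 2 ≤ (s - 1) ^ 2 := by nlinarith
      have hs1 : (1 : ℤ) ≤ s := by exact_mod_cast hs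
      rw [if_neg hz, if_neg hne, min_eq_right (by linarith), max_eq_right (by nlinarith), abs_le]
      constructor <;> linarith

theorem abs_potential_sub_le (hs : 0 < s) (x : Fin ℓ → Fin s) (u v : CombVertex ℓ s)
    (h : (graph ℓ s).Adj u v) : |potential x v - potential x u| ≤ 1 := by
  rcases h with h | h
  · exact abs_potential_sub_le_of_step hs x h
  · rw [abs_sub_comm]
    exact abs_potential_sub_le_of_step hs x h

open SimpleGraph

theorem hasWalk_spine {u v : CombVertex ℓ s} (hside : v.side = u.side) (hlevel : v.level = u.level)
    (hcoord : v.coord = u.coord) (hu : u.depth = 0) (hv : v.depth = 0) (h : u.spine ≤ v.spine) :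
    (graph ℓ s).HasWalk u v (v.spine - u.spine) := by
  obtain ⟨n, hn⟩ := Int.eq_ofNat_of_zero_le (sub_nonneg.2 h)
  rw [hn]
  induction n generalizing v with
  | zero =>
    obtain rfl : u = v := CombVertex.ext hside.symm hlevel.symm hcoord.symm (by omega) (by omega)
    exact HasWalk.refl u
  | succ n ih =>
    let v' : CombVertex ℓ s := { v with
      spine := v.spine - 1
      neg_le_spine := by have := u.neg_le_spine; omega
      spine_le := by have := v.spine_le; omega }
    push_cast
    refine (ih (v := v') hside hlevel hcoord hv ?_ ?_).trans (HasWalk.of_adj (Or.inl ?_))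
    · change u.spine ≤ v.spine - 1
      omega
    · change v.spine - 1 - u.spine = n
      omega
    · exact .spine rfl rfl rfl (sub_add_cancel _ _).symm hv hv

theorem hasWalk_tooth {u v : CombVertex ℓ s} (hside : v.side = u.side) (hlevel : v.level = u.level)
    (hcoord : v.coord = u.coord) (hspine : v.spine = u.spine) (hu : u.depth = 0) :
    (graph ℓ s).HasWalk u v v.depth := by
  obtain ⟨n, hn⟩ : ∃ n, v.depth = n := ⟨_, rfl⟩
  rw [hn]
  induction n generalizing v with
  | zero =>
    obtain rfl : u = v :=
      CombVertex.ext hside.symm hlevel.symm hcoord.symm hspine.symm (by omega)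
    exact HasWalk.refl u
  | succ n ih =>
    let v' : CombVertex ℓ s := { v with
      depth := n
      depth_le := by have := v.depth_le; omega }
    push_cast
    exact (ih (v := v') hside hlevel hcoord hspine rfl).trans
      (HasWalk.of_adj (Or.inl (.tooth rfl rfl rfl rfl hn)))

/-- The central spine vertex of a comb. -/
def center (σ : Bool) (i : ℕ) (hi : i ≤ ℓ) (z : Fin ℓ → Fin s) : CombVertex ℓ s where
  side := σ
  level := i
  level_le := hi
  coord := z
  spine := 0
  neg_le_spine := neg_nonpos.2 (by positivity)
  spine_le := by positivity
  depth := 0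
  depth_le := Nat.zero_le _

/-- The end of the central tooth of a comb on the last level. -/
def middle (σ : Bool) (z : Fin ℓ → Fin s) : CombVertex ℓ s where
  side := σ
  level := ℓ
  level_le := le_rfl
  coord := z
  spine := 0
  neg_le_spine := neg_nonpos.2 (by positivity)
  spine_le := by positivity
  depth := 12 * s ^ 2
  depth_le := le_rfl

theorem hasWalk_center_succ (σ : Bool) {z z' : Fin ℓ → Fin s} {i : Fin ℓ}
    (h : ∀ j, j ≠ i → z' j = z j) :
    (graph ℓ s).HasWalk (center σ i i.2.le z) (center σ (i + 1) i.2 z')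
      (24 * s ^ 2 + 3 + 4 * ((z' i : ℤ) - z i) ^ 2) := by
  have hp := combPort_pos ((z' i : ℤ) - z i)
  have hn := combPort_pos ((z i : ℤ) - z' i)
  have hp' : combPort ((z' i : ℤ) - z i) ≤ 4 * s ^ 2 := combPort_le (by rw [abs_lt]; omega)
  have hn' : combPort ((z i : ℤ) - z' i) ≤ 4 * s ^ 2 := combPort_le (by rw [abs_lt]; omega)
  let a (k : ℕ) (hk : k ≤ 12 * s ^ 2) : CombVertex ℓ s :=
    ⟨σ, i, i.2.le, z, combPort ((z' i : ℤ) - z i), by linarith, hp', k, hk⟩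
  let b (k : ℕ) (hk : k ≤ 12 * s ^ 2) : CombVertex ℓ s :=
    ⟨σ, i + 1, i.2, z', -combPort ((z i : ℤ) - z' i), by linarith, by linarith, k, hk⟩
  have w₁ := hasWalk_spine (u := center σ i i.2.le z) (v := a 0 (Nat.zero_le _))
    rfl rfl rfl rfl rfl hp.le
  have w₂ := hasWalk_tooth (u := a 0 (Nat.zero_le _)) (v := a _ le_rfl) rfl rfl rfl rfl rfl
  have w₃ : (graph ℓ s).HasWalk (a _ le_rfl) (b _ le_rfl) 1 :=
    HasWalk.of_adj (Or.inl (.port i rfl rfl rfl h rfl rfl rfl rfl))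
  have w₄ := hasWalk_tooth (u := b 0 (Nat.zero_le _)) (v := b _ le_rfl) rfl rfl rfl rfl rfl
  have w₅ := hasWalk_spine (u := b 0 (Nat.zero_le _)) (v := center σ (i + 1) i.2 z')
    rfl rfl rfl rfl rfl (neg_nonpos.2 hn.le)
  convert (((w₁.trans w₂).trans w₃).trans w₄.symm).trans w₅ using 1
  simp only [a, b, center, combPort]
  push_cast
  ring

theorem hasWalk_center (σ : Bool) (x z : Fin ℓ → Fin s) :
    (graph ℓ s).HasWalk (center σ 0 (Nat.zero_le _) x) (center σ ℓ le_rfl z)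
      (baseHeight x z ℓ) := by
  let y (n : ℕ) (j : Fin ℓ) : Fin s := if (j : ℕ) < n then z j else x j
  have key (n : ℕ) (hn : n ≤ ℓ) : (graph ℓ s).HasWalk (center σ 0 (Nat.zero_le _) x)
      (center σ n hn (y n)) (baseHeight x (y n) n) := by
    induction n with
    | zero =>
      have : y 0 = x := by simp [y]
      rw [this, baseHeight_zero]
      exact HasWalk.refl _
    | succ n ih =>
      have hy : ∀ j, j ≠ (⟨n, hn⟩ : Fin ℓ) → y (n + 1) j = y n j := by
        intro j hj
        have := Fin.val_ne_of_ne hj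
        have h : (j : ℕ) < n + 1 ↔ (j : ℕ) < n := by simp only at this; omega
        simp only [y, h]
      have hx : y n ⟨n, hn⟩ = x ⟨n, hn⟩ := by simp [y]
      have hb := baseHeight_succ x hy
      rw [if_pos (by rw [hx, sub_self])] at hb
      have hw := hasWalk_center_succ σ hy
      rw [hx] at hw
      convert (ih (Nat.le_of_succ_le hn)).trans hw using 1
      rw [hb]
      ring
  have hz : y ℓ = z := by simp [y]
  simpa only [hz] using key ℓ le_rfl

theorem hasWalk_middle (σ : Bool) (x z : Fin ℓ → Fin s) :
    (graph ℓ s).HasWalk (center σ 0 (Nat.zero_le _) x) (middle σ z)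
      (baseHeight x z ℓ + 12 * s ^ 2) := by
  have h := (hasWalk_center σ x z).trans
    (hasWalk_tooth (u := center σ ℓ le_rfl z) (v := middle σ z) rfl rfl rfl rfl rfl)
  simpa [middle] using h

theorem adj_middle (z : Fin ℓ → Fin s) : (graph ℓ s).Adj (middle false z) (middle true z) :=
  Or.inl (.bridge rfl rfl rfl rfl rfl rfl rfl rfl rfl)

theorem connected_graph (hs : 0 < s) : (graph ℓ s).Connected := by
  have : Nonempty (CombVertex ℓ s) := ⟨middle false fun _ => ⟨0, hs⟩⟩
  let o : Fin ℓ → Fin s := fun _ => ⟨0, hs⟩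
  have hdown (σ : Bool) (z : Fin ℓ → Fin s) (n : ℕ) (hn : n ≤ ℓ) :
      (graph ℓ s).Reachable (center σ n hn z) (center σ 0 (Nat.zero_le _) z) := by
    induction n with
    | zero => rfl
    | succ n ih =>
      have h := hasWalk_center_succ σ (z := z) (z' := z) (i := ⟨n, hn⟩) fun _ _ => rfl
      exact h.reachable.symm.trans (ih (Nat.le_of_succ_le hn))
  have hmid (σ : Bool) : (graph ℓ s).Reachable (middle σ o) (middle false o) := by
    cases σ
    · rfl
    · exact (adj_middle o).reachable.symm
  have h (u : CombVertex ℓ s) : (graph ℓ s).Reachable u (middle false o) := by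
    let u' : CombVertex ℓ s := { u with depth := 0, depth_le := Nat.zero_le _ }
    have h₁ : (graph ℓ s).Reachable u u' :=
      (hasWalk_tooth (u := u') (v := u) rfl rfl rfl rfl rfl).reachable.symm
    let c := center u.side u.level u.level_le u.coord
    have h₂ : (graph ℓ s).Reachable u' c := by
      rcases le_total u.spine 0 with hu | hu
      · exact (hasWalk_spine (u := u') (v := c) rfl rfl rfl rfl rfl hu).reachable
      · exact (hasWalk_spine (u := c) (v := u') rfl rfl rfl rfl rfl hu).reachable.symm
    exact ((h₁.trans h₂).trans (hdown _ _ _ _)).trans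
      ((hasWalk_middle u.side u.coord o).reachable.trans (hmid _))
  exact ⟨fun u v => (h u).trans (h v).symm⟩

theorem potential_center (hs : 0 < s) (σ : Bool) (x : Fin ℓ → Fin s) :
    potential x (center σ 0 (Nat.zero_le _) x) = 0 := by
  rw [potential_of_depth_eq_zero hs x rfl]
  exact (add_zero _).trans (baseHeight_zero x)

theorem potential_middle (σ : Bool) (x z : Fin ℓ → Fin s) :
    potential x (middle σ z) = baseHeight x z ℓ + 12 * s ^ 2 := by
  have : (0 : ℤ) ≤ s ^ 2 := by positivity
  have hd : deviation x z ℓ = 0 := by simp [deviation]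
  simp only [potential, middle, le_refl, if_true, hd]
  push_cast
  rw [min_eq_left (by linarith)]
  ring

theorem le_dist_middle (hs : 0 < s) (σ τ : Bool) (x z : Fin ℓ → Fin s) :
    baseHeight x z ℓ + 12 * s ^ 2 ≤
      (graph ℓ s).dist (center σ 0 (Nat.zero_le _) x) (middle τ z) := by
  have h := (connected_graph hs).sub_le_dist_of_lipschitz (abs_potential_sub_le hs x)
    (center σ 0 (Nat.zero_le _) x) (middle τ z)
  rwa [potential_center hs, potential_middle, sub_zero] at h

/-- Opposite sides are separated by the middle vertices. -/
theorem exists_middle_between (hs : 0 < s) {u v : CombVertex ℓ s} (hu : u.side = false)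
    (hv : v.side = true) : ∃ z, (graph ℓ s).dist u (middle false z) +
      (graph ℓ s).dist (middle false z) v = (graph ℓ s).dist u v := by
  classical
  have hG := connected_graph (ℓ := ℓ) hs
  obtain ⟨p, hp⟩ := hG.exists_walk_length_eq_dist u v
  obtain ⟨d, hd, hf, hsnd⟩ := p.exists_boundary_dart {w | w.side = false} hu (by simp [hv])
  simp only [Set.mem_ofPred_eq, Bool.not_eq_false] at hf hsnd
  have hmid : d.fst = middle false d.fst.coord := by
    rcases d.adj with h | h <;> cases h
    all_goals first
      | exact CombVertex.ext ‹_› ‹_› rfl ‹_› ‹_›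
      | simp_all
  have hmem := p.dart_fst_mem_support_of_mem_darts hd
  rw [hmid] at hmem
  refine ⟨d.fst.coord, le_antisymm ?_ hG.dist_triangle⟩
  rw [← hp, ← p.take_spec hmem, Walk.length_append]
  exact add_le_add (dist_le _) (dist_le _)

theorem eq_of_middle_between (hs : 0 < s) {x y m z : Fin ℓ → Fin s}
    (hm : ∀ i, (x i : ℤ) + y i = 2 * m i)
    (h : (graph ℓ s).dist (center false 0 (Nat.zero_le _) x) (middle false z) +
      (graph ℓ s).dist (middle false z) (center true 0 (Nat.zero_le _) y) =
      (graph ℓ s).dist (center false 0 (Nat.zero_le _) x) (center true 0 (Nat.zero_le _) y)) :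
    z = m := by
  have hle := (((hasWalk_middle false x m).trans (HasWalk.of_adj (adj_middle m))).trans
    (hasWalk_middle true y m).symm).dist_le
  have h₁ := le_dist_middle hs false false x z
  have h₂ := le_dist_middle hs true false y z
  rw [dist_comm] at h₂
  rw [← h] at hle
  push_cast at hle
  simp only [baseHeight_last] at hle h₁ h₂
  have hsum : ∑ j, ((z j : ℤ) - x j) ^ 2 + ∑ j, ((z j : ℤ) - y j) ^ 2 =
      ∑ j, ((m j : ℤ) - x j) ^ 2 + ∑ j, ((m j : ℤ) - y j) ^ 2 + 2 * ∑ j, ((z j : ℤ) - m j) ^ 2 := by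
    rw [Finset.mul_sum]
    simp only [← Finset.sum_add_distrib]
    refine Finset.sum_congr rfl fun j _ => ?_
    have hy : (y j : ℤ) = 2 * m j - x j := by linarith [hm j]
    rw [hy]
    ring
  have hzero : ∑ j, ((z j : ℤ) - m j) ^ 2 = 0 :=
    le_antisymm (by omega) (Finset.sum_nonneg fun _ _ => sq_nonneg _)
  rw [Finset.sum_eq_zero_iff_of_nonneg fun _ _ => sq_nonneg _] at hzero
  funext j
  have := pow_eq_zero_iff (two_ne_zero) |>.1 (hzero j (Finset.mem_univ j))
  exact Fin.ext (by omega)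

/-- Hub labelings of the comb graph are large. -/
theorem pow_le_two_mul_sum_card {r q : ℕ} (hs : 0 < s) (hrq : r + 2 * q ≤ s + 2)
    {S : CombVertex ℓ s → Finset (CombVertex ℓ s)} (hS : IsHubLabeling (graph ℓ s) S) :
    r ^ ℓ * q ^ ℓ ≤ 2 * ∑ v, (S v).card := by
  have hG := connected_graph (ℓ := ℓ) hs
  let vec (c : ℕ) (hc : c ≤ 2) (a : (Fin ℓ → Fin r) × (Fin ℓ → Fin q)) (i : Fin ℓ) : Fin s :=
    ⟨a.1 i + c * a.2 i, by
      have := (a.1 i).2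
      have := (a.2 i).2
      have := Nat.mul_le_mul_right (a.2 i : ℕ) hc
      omega⟩
  let x := vec 0 (by omega)
  let m := vec 1 (by omega)
  let y := vec 2 (by omega)
  have hxy (a) (i) : (x a i : ℤ) + y a i = 2 * m a i := by
    simp only [x, y, m, vec]
    push_cast
    ring
  have h := hG.card_le_two_mul_sum_card_of_isHubLabeling
    (fun a => center false 0 (Nat.zero_le _) (x a)) (fun a => center true 0 (Nat.zero_le _) (y a))
    (fun a => middle false (m a)) ?_ ?_ hS
  · simpa using h
  · intro a w hw
    cases hside : w.side with
    | false =>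
      obtain ⟨z, hz⟩ := exists_middle_between hs hside
        (v := center true 0 (Nat.zero_le _) (y a)) rfl
      have t₁ := hG.dist_triangle (u := center false 0 (Nat.zero_le _) (x a)) (v := w)
        (w := middle false z)
      have t₂ := hG.dist_triangle (u := center false 0 (Nat.zero_le _) (x a)) (v := middle false z)
        (w := center true 0 (Nat.zero_le _) (y a))
      obtain rfl := eq_of_middle_between hs (hxy a) (z := z) (by omega)
      exact Or.inr hz
    | true =>
      obtain ⟨z, hz⟩ := exists_middle_between hs
        (u := center false 0 (Nat.zero_le _) (x a)) rfl hside
      have t₁ := hG.dist_triangle (u := middle false z) (v := w)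
        (w := center true 0 (Nat.zero_le _) (y a))
      have t₂ := hG.dist_triangle (u := center false 0 (Nat.zero_le _) (x a)) (v := middle false z)
        (w := center true 0 (Nat.zero_le _) (y a))
      obtain rfl := eq_of_middle_between hs (hxy a) (z := z) (by omega)
      exact Or.inl hz
  · intro a a' hend hbetween
    have hm := eq_of_middle_between hs (hxy a') hbetween
    have hend' : x a = x a' ∨ y a = y a' :=
      hend.imp (congrArg CombVertex.coord) (congrArg CombVertex.coord)
    have hcoord (i : Fin ℓ) : (a.1 i : ℕ) = a'.1 i ∧ (a.2 i : ℕ) = a'.2 i := by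
      have h₁ := congrArg Fin.val (congrFun hm i)
      rcases hend' with h | h <;> have h₂ := congrArg Fin.val (congrFun h i) <;>
        simp only [x, y, m, vec] at h₁ h₂ <;> omega
    exact Prod.ext (funext fun i => Fin.ext (hcoord i).1) (funext fun i => Fin.ext (hcoord i).2)

end CombVertex

/-- There is an absolute constant `C > 0` such that for all `b, ℓ ≥ 1` there is a connected
graph `G_{b,ℓ}` with (i) `2^{bℓ} ≤ n ≤ 2^{bℓ}·2^{C(b+log₂(ℓ+1))}` vertices,
(ii) maximum degree at most `3`, and (iii) every hub labeling has total hub size at least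
`n · 2^{bℓ} · 2^{-C(b+ℓ)}`. -/
theorem hub_labeling_lower_bound_family :
    ∃ C : ℝ, 0 < C ∧
      ∀ b ℓ : ℕ, 1 ≤ b → 1 ≤ ℓ →
        ∃ n : ℕ, ∃ G : SimpleGraph (Fin n), G.Connected ∧
          2 ^ (b * ℓ) ≤ n ∧
          (n : ℝ) ≤ (2 : ℝ) ^ (b * ℓ) * 2 ^ (C * ((b : ℝ) + Real.logb 2 ((ℓ : ℝ) + 1))) ∧
          (∀ v : Fin n, (G.neighborSet v).ncard ≤ 3) ∧
          ∀ S : Fin n → Finset (Fin n), IsHubLabeling G S →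
            (n : ℝ) * ((2 : ℝ) ^ (b * ℓ) * 2 ^ (-C * ((b : ℝ) + (ℓ : ℝ)))) ≤
              ∑ v : Fin n, ((S v).card : ℝ) := by
  refine ⟨12, by norm_num, fun b ℓ hb hℓ => ?_⟩
  obtain ⟨c, rfl⟩ := Nat.exists_eq_add_of_le' hb
  set s := 2 ^ (c + 1) with hsdef
  have hs : 0 < s := by positivity
  have hsℓ : s ^ ℓ = 2 ^ ((c + 1) * ℓ) := by rw [hsdef, ← pow_mul]
  let e := (CombVertex.graph ℓ s).overFinIso rfl
  have hG := CombVertex.connected_graph (ℓ := ℓ) hs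
  have hn := CombVertex.card_eq (ℓ := ℓ) (s := s)
  have hcard : Fintype.card (CombVertex ℓ s) ≤
      2 ^ (8 + 4 * (c + 1)) * ((ℓ + 1) * 2 ^ ((c + 1) * ℓ)) := by
    have hs2 : 1 ≤ s ^ 2 := Nat.one_le_pow _ _ hs
    have : (8 * s ^ 2 + 1) * (12 * s ^ 2 + 1) ≤ 2 ^ 7 * s ^ 4 := by nlinarith
    rw [hn, hsℓ, show 2 ^ (8 + 4 * (c + 1)) = 2 * (2 ^ 7 * s ^ 4) by rw [hsdef, ← pow_mul]; ring]
    calc 2 * ((ℓ + 1) * (2 ^ ((c + 1) * ℓ) * ((8 * s ^ 2 + 1) * (12 * s ^ 2 + 1))))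
        ≤ 2 * ((ℓ + 1) * (2 ^ ((c + 1) * ℓ) * (2 ^ 7 * s ^ 4))) := by gcongr
      _ = _ := by ring
  refine ⟨Fintype.card (CombVertex ℓ s), _, e.connected_iff.1 hG, ?_, ?_, ?_, ?_⟩
  · rw [hn, hsℓ]
    calc 2 ^ ((c + 1) * ℓ) = 1 * (1 * (2 ^ ((c + 1) * ℓ) * (1 * 1))) := by ring
      _ ≤ _ := by gcongr <;> omega
  · have hℓ1 : (0 : ℝ) < (ℓ : ℝ) + 1 := by positivity
    have hlog : 0 ≤ Real.logb 2 ((ℓ : ℝ) + 1) :=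
      Real.logb_nonneg (by norm_num) (by linarith [Nat.cast_nonneg (α := ℝ) ℓ])
    have hpow : (2 : ℝ) ^ (8 + 4 * (c + 1)) * ((ℓ : ℝ) + 1) =
        (2 : ℝ) ^ ((8 + 4 * ((c : ℝ) + 1)) + Real.logb 2 ((ℓ : ℝ) + 1)) := by
      rw [Real.rpow_add (by norm_num), Real.rpow_logb (by norm_num) (by norm_num) hℓ1,
        ← Real.rpow_natCast]
      push_cast
      rfl
    calc (Fintype.card (CombVertex ℓ s) : ℝ)
        ≤ 2 ^ (8 + 4 * (c + 1)) * (((ℓ : ℝ) + 1) * 2 ^ ((c + 1) * ℓ)) := by exact_mod_cast hcard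
      _ = 2 ^ ((c + 1) * ℓ) *
          (2 : ℝ) ^ ((8 + 4 * ((c : ℝ) + 1)) + Real.logb 2 ((ℓ : ℝ) + 1)) := by
        rw [← hpow]; ring
      _ ≤ _ := by
        gcongr
        · norm_num
        · push_cast
          linarith [Nat.cast_nonneg (α := ℝ) c]
  · intro v
    have h := CombVertex.ncard_neighborSet_le hs (e.symm v)
    rwa [← Set.ncard_congr' (e.symm.mapNeighborSet v)] at h
  · intro S hS
    have h := CombVertex.pow_le_two_mul_sum_card (r := s / 2) (q := s / 4 + 1) hs (by omega)
      (e.isHubLabeling_map hG hS)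
    simp only [Finset.card_map] at h
    have hsum : ∑ x, (S (e x)).card = ∑ v, (S v).card :=
      Equiv.sum_comp e.toEquiv fun v => (S v).card
    rw [hsum] at h
    have hs8 : s * s ≤ 8 * (s / 2 * (s / 4 + 1)) := by
      have h2 : s = 2 * (s / 2) := by omega
      have h4 : s ≤ 4 * (s / 4 + 1) := by omega
      calc s * s ≤ (2 * (s / 2)) * (4 * (s / 4 + 1)) := Nat.mul_le_mul h2.le h4
        _ = _ := by ring
    have hpairs : 2 ^ ((c + 1) * ℓ) * 2 ^ ((c + 1) * ℓ) ≤ 2 ^ (3 * ℓ + 1) * ∑ v, (S v).card := by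
      calc 2 ^ ((c + 1) * ℓ) * 2 ^ ((c + 1) * ℓ) = (s * s) ^ ℓ := by rw [mul_pow, hsℓ]
        _ ≤ (8 * (s / 2 * (s / 4 + 1))) ^ ℓ := by gcongr
        _ = 8 ^ ℓ * ((s / 2) ^ ℓ * (s / 4 + 1) ^ ℓ) := by rw [mul_pow, mul_pow]
        _ ≤ 8 ^ ℓ * (2 * ∑ v, (S v).card) := by gcongr
        _ = _ := by rw [pow_succ, pow_mul]; ring
    have htotal : Fintype.card (CombVertex ℓ s) * 2 ^ ((c + 1) * ℓ) ≤
        2 ^ (12 * (c + 1 + ℓ)) * ∑ v, (S v).card := by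
      calc Fintype.card (CombVertex ℓ s) * 2 ^ ((c + 1) * ℓ)
          ≤ (2 ^ (8 + 4 * (c + 1)) * ((ℓ + 1) * 2 ^ ((c + 1) * ℓ))) * 2 ^ ((c + 1) * ℓ) := by gcongr
        _ = (2 ^ (8 + 4 * (c + 1)) * (ℓ + 1)) * (2 ^ ((c + 1) * ℓ) * 2 ^ ((c + 1) * ℓ)) := by ring
        _ ≤ (2 ^ (8 + 4 * (c + 1)) * 2 ^ ℓ) * (2 ^ (3 * ℓ + 1) * ∑ v, (S v).card) := by
          gcongr
          exact Nat.lt_two_pow_self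
        _ = 2 ^ (8 + 4 * (c + 1) + ℓ + (3 * ℓ + 1)) * ∑ v, (S v).card := by
          rw [pow_add _ (_ + ℓ), pow_add _ _ ℓ]; ring
        _ ≤ _ := by
          gcongr
          · norm_num
          · omega
    have htotal' : (Fintype.card (CombVertex ℓ s) : ℝ) * 2 ^ ((c + 1) * ℓ) ≤
        2 ^ (12 * (c + 1 + ℓ)) * ∑ v, ((S v).card : ℝ) := by exact_mod_cast htotal
    have hexp : (2 : ℝ) ^ (-12 * (((c + 1 : ℕ) : ℝ) + (ℓ : ℝ))) =
        ((2 : ℝ) ^ (12 * (c + 1 + ℓ)))⁻¹ := by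
      rw [← Real.rpow_natCast, ← Real.rpow_neg (by norm_num)]
      push_cast
      ring_nf
    rw [hexp, ← mul_assoc, ← div_eq_mul_inv, div_le_iff₀ (by positivity)]
    linarith
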